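/- Let G=(V,E) be a finite simple graph on n ≥ 2 vertices, let E_+ be a set of non-edges of G, let E_- ⊆ E, let b = |E_+| + |E_-|, and let Δ ≥ 2 be the maximum degree of the graph (V, E ∪ E_+). For a permutation position j, define Z_j = min(Δ², ((n log n)/j)²), where log denotes the base-2 logarithm. Run InfluenceMIS on (V, E ∪ E_+) with V_1^? = ∅ and E_1^? = E_+ ∪ E_-, with π drawn uniformly at random from all permutations of V. Then there is an absolute constant C such that E[ Σ_j Z_j · 1[the vertex π(j) is added to the influence set at iteration j] ] ≤ C · b · log² n · log Δ. -/

import Mathlib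

open Finset

/-- `lfmisAux W E π i` : the vertex at π-position `i` is in the greedy
lexicographically-first MIS of the graph with vertex set `W` and edge set `E`. -/
def lfmisAux {n : ℕ} (W : Set (Fin n)) (E : Set (Sym2 (Fin n))) (π : Equiv.Perm (Fin n))
    (i : ℕ) : Prop :=
  (∃ h : i < n, π ⟨i, h⟩ ∈ W) ∧
    ∀ j, j < i →
      (∃ (h1 : j < n) (h2 : i < n), π ⟨j, h1⟩ ∈ W ∧ π ⟨i, h2⟩ ∈ W ∧
        s(π ⟨j, h1⟩, π ⟨i, h2⟩) ∈ E) → ¬ lfmisAux W E π j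
termination_by i

/-- The lexicographically-first MIS of the graph with vertex set `W ⊆ Fin n`
and edge set `E`, under the permutation `π` (position `i` holds vertex `π i`). -/
def LFMISOn {n : ℕ} (W : Set (Fin n)) (E : Set (Sym2 (Fin n)))
    (π : Equiv.Perm (Fin n)) : Set (Fin n) :=
  {v | v ∈ W ∧ lfmisAux W E π (π.symm v : ℕ)}

/-- State of the `InfluenceMIS` procedure: alive vertices, surviving edges,
undecided vertices, undecided edges. -/
structure MISState (n : ℕ) where
  verts : Finset (Fin n)
  edges : Finset (Sym2 (Fin n))
  uV : Finset (Fin n)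
  uE : Finset (Sym2 (Fin n))

/-- Current neighbors of `u`. -/
def MISState.nbrs {n : ℕ} (st : MISState n) (u : Fin n) : Finset (Fin n) :=
  st.verts.filter fun v => v ≠ u ∧ s(u, v) ∈ st.edges

/-- One iteration of `InfluenceMIS`, processing vertex `u`.  If `u` is not alive,
nothing happens.  If `u` is undecided, all of its neighbors become undecided and
`u` is deleted (it joins the influence set).  Otherwise `u` is (implicitly) added
to the MIS: its neighbors along undecided edges become undecided, its neighbors
along decided edges are deleted, and `u` is deleted. -/
def stepInf {n : ℕ} (st : MISState n) (u : Fin n) : MISState n :=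
  if u ∉ st.verts then st
  else if u ∈ st.uV then
    { verts := st.verts.erase u
      edges := st.edges.filter fun e => u ∉ e
      uV := (st.uV ∪ st.nbrs u).erase u
      uE := st.uE.filter fun e => u ∉ e }
  else
    let D := (st.nbrs u).filter fun v => s(u, v) ∉ st.uE
    let U := (st.nbrs u).filter fun v => s(u, v) ∈ st.uE
    { verts := (st.verts.erase u) \ D
      edges := st.edges.filter fun e => u ∉ e ∧ ∀ v ∈ D, v ∉ e
      uV := ((st.uV ∪ U) \ D).erase u
      uE := st.uE.filter fun e => u ∉ e ∧ ∀ v ∈ D, v ∉ e }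

/-- `stateAt π st0 i` : the state at the beginning of (0-based) iteration `i`
of `InfluenceMIS` started from `st0`, where position `i` holds vertex `π i`
(so 1-based iteration `i` of the paper corresponds to `stateAt π st0 (i-1)`). -/
def stateAt {n : ℕ} (π : Equiv.Perm (Fin n)) (st0 : MISState n) : ℕ → MISState n
  | 0 => st0
  | i + 1 => if h : i < n then stepInf (stateAt π st0 i) (π ⟨i, h⟩) else stateAt π st0 i

/-- The influence set returned by `InfluenceMIS`: vertices that are alive and
undecided at the beginning of their own iteration. -/
def influenceMIS {n : ℕ} (π : Equiv.Perm (Fin n)) (st0 : MISState n) : Finset (Fin n) :=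
  Finset.univ.filter fun v =>
    v ∈ (stateAt π st0 (π.symm v : ℕ)).verts ∧ v ∈ (stateAt π st0 (π.symm v : ℕ)).uV

/-- Initial state of `InfluenceMIS` on a graph `G` with undecided vertices `uV`
and undecided edges `uE`. -/
def initState {n : ℕ} (G : SimpleGraph (Fin n)) [DecidableRel G.Adj]
    (uV : Finset (Fin n)) (uE : Finset (Sym2 (Fin n))) : MISState n :=
  ⟨Finset.univ, G.edgeFinset, uV, uE⟩

/-- Undecided vertices are alive, alive vertices lie in `R`, and undecided edges are
non-loops joining alive vertices. -/
structure MISState.Valid {n : ℕ} (st : MISState n) (R : Finset (Fin n)) : Prop where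
  uV_subset : st.uV ⊆ st.verts
  verts_subset : st.verts ⊆ R
  mem_verts : ∀ e ∈ st.uE, ∀ v ∈ e, v ∈ st.verts
  not_isDiag : ∀ e ∈ st.uE, ¬ e.IsDiag

namespace MISState

variable {n : ℕ} {st : MISState n} {R : Finset (Fin n)}

lemma mem_nbrs {u v : Fin n} : v ∈ st.nbrs u ↔ v ∈ st.verts ∧ v ≠ u ∧ s(u, v) ∈ st.edges := by
  simp [nbrs]

lemma mem_nbrs_comm {u v : Fin n} (hu : u ∈ st.verts) (hv : v ∈ st.verts) :
    v ∈ st.nbrs u ↔ u ∈ st.nbrs v := by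
  simp only [mem_nbrs, hu, hv, true_and, Sym2.eq_swap (a := u) (b := v), ne_comm (a := u)]

lemma Valid.stepInf (h : st.Valid R) (u : Fin n) : (stepInf st u).Valid (R.erase u) := by
  obtain ⟨h1, h2, h3, h4⟩ := h
  unfold _root_.stepInf
  split_ifs with hu hx
  · refine ⟨?_, erase_subset_erase _ h2, ?_, fun e he => h4 e (mem_filter.1 he).1⟩
    · refine erase_subset_erase _ (union_subset h1 (filter_subset _ _))
    · intro e he v hv
      rw [mem_filter] at he
      exact mem_erase.2 ⟨fun e' => he.2 (e' ▸ hv), h3 e he.1 v hv⟩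
  · refine ⟨?_, sdiff_subset.trans (erase_subset_erase _ h2), ?_,
      fun e he => h4 e (mem_filter.1 he).1⟩
    · intro v hv
      simp only [mem_erase, mem_sdiff, mem_union, mem_filter, mem_nbrs] at hv ⊢
      refine ⟨⟨hv.1, ?_⟩, hv.2.2⟩
      rcases hv.2.1 with hv | hv
      · exact h1 hv
      · exact hv.1.1
    · intro e he v hv
      rw [mem_filter] at he
      exact mem_sdiff.2 ⟨mem_erase.2 ⟨fun e' => he.2.1 (e' ▸ hv), h3 e he.1 v hv⟩,
        fun hD => he.2.2 v hD hv⟩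
  · exact ⟨h1, fun v hv => mem_erase.2 ⟨fun e => hu (e ▸ hv), h2 hv⟩, h3, h4⟩

lemma uE_stepInf_subset (h : st.Valid R) (u : Fin n) :
    (_root_.stepInf st u).uE ⊆ st.uE.filter fun e => u ∉ e := by
  unfold _root_.stepInf
  split_ifs with hu hx
  · exact subset_rfl
  · exact fun e he => mem_filter.2 ⟨(mem_filter.1 he).1, (mem_filter.1 he).2.1⟩
  · exact fun e he => mem_filter.2 ⟨he, fun hue => hu (h.mem_verts e he u hue)⟩

lemma Valid.card_filter_mem (h : st.Valid R) {e : Sym2 (Fin n)} (he : e ∈ st.uE) :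
    #{u ∈ R | u ∈ e} = 2 := by
  rw [← Sym2.card_toFinset_of_not_isDiag e (h.not_isDiag e he)]
  congr 1
  ext u
  simp only [mem_filter, Sym2.mem_toFinset, and_iff_right_iff_imp]
  exact fun hu => h.verts_subset (h.mem_verts e he u hu)

lemma Valid.sum_card_incident (h : st.Valid R) :
    ∑ u ∈ R, #{e ∈ st.uE | u ∈ e} = 2 * #st.uE := by
  have := sum_card_bipartiteAbove_eq_sum_card_bipartiteBelow
    (s := R) (t := st.uE) (fun u e => u ∈ e)
  simp only [bipartiteAbove, bipartiteBelow] at this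
  rw [this, sum_congr rfl fun e he => h.card_filter_mem he]
  simp [mul_comm]

lemma Valid.sum_card_uE_stepInf_le (h : st.Valid R) :
    ∑ u ∈ R, (#(_root_.stepInf st u).uE : ℤ) ≤ (#R - 2) * #st.uE := by
  have h1 : ∀ u ∈ R, (#(_root_.stepInf st u).uE : ℤ) ≤ #st.uE - #{e ∈ st.uE | u ∈ e} := by
    intro u _
    have := card_le_card (uE_stepInf_subset h u)
    have := card_filter_add_card_filter_not (s := st.uE) (fun e => u ∈ e)
    omega
  refine (sum_le_sum h1).trans ?_
  have : ∑ u ∈ R, (#{e ∈ st.uE | u ∈ e} : ℤ) = 2 * #st.uE := mod_cast h.sum_card_incident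
  rw [sum_sub_distrib, this, sum_const, nsmul_eq_mul]
  linarith

lemma card_nbrs_filter_le (u : Fin n) :
    #{v ∈ st.nbrs u | s(u, v) ∈ st.uE} ≤ #{e ∈ st.uE | u ∈ e} := by
  refine card_le_card_of_injOn (fun v => s(u, v)) ?_ ?_
  · intro v hv
    simp only [coe_filter, Set.mem_ofPred_eq] at hv ⊢
    exact ⟨hv.2, by simp⟩
  · intro v _ w _ hvw
    exact Sym2.congr_right.1 hvw

lemma card_uV_stepInf_of_notMem {u : Fin n} (hu : u ∉ st.verts) :
    #(_root_.stepInf st u).uV = #st.uV := by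
  simp [_root_.stepInf, hu]

lemma card_uV_stepInf_of_mem_uV {u : Fin n} (hu : u ∈ st.verts) (hx : u ∈ st.uV) :
    (#(_root_.stepInf st u).uV : ℤ) = #st.uV - 1 + #(st.nbrs u \ st.uV) := by
  simp only [_root_.stepInf, hu, hx, not_true_eq_false, if_false, if_true]
  have h1 := card_erase_add_one (mem_union_left (st.nbrs u) hx)
  have h2 := card_union_of_disjoint (disjoint_sdiff (s := st.uV) (t := st.nbrs u))
  rw [union_sdiff_self_eq_union] at h2
  omega

lemma card_uV_stepInf_le_of_notMem_uV {u : Fin n} (hu : u ∈ st.verts) (hx : u ∉ st.uV) :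
    (#(_root_.stepInf st u).uV : ℤ) ≤
      #st.uV + #{v ∈ st.nbrs u | s(u, v) ∈ st.uE} - #(st.nbrs u ∩ st.uV) := by
  simp only [_root_.stepInf, hu, hx, not_true_eq_false, if_false]
  set U := {v ∈ st.nbrs u | s(u, v) ∈ st.uE}
  set D := {v ∈ st.nbrs u | s(u, v) ∉ st.uE}
  have hUD : st.nbrs u = U ∪ D := (filter_union_filter_not_eq _ _).symm
  have h1 : ((st.uV ∪ U) \ D).erase u ⊆ (st.uV \ st.nbrs u) ∪ U := by
    intro v hv
    rw [hUD]
    simp only [mem_erase, mem_sdiff, mem_union] at hv ⊢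
    tauto
  have h2 := (card_le_card h1).trans (card_union_le _ _)
  have h3 := card_sdiff_add_card_inter st.uV (st.nbrs u)
  rw [inter_comm] at h3
  omega

lemma Valid.sum_card_uV_stepInf_le (h : st.Valid R) :
    ∑ u ∈ R, (#(_root_.stepInf st u).uV : ℤ) ≤ (#R - 1) * #st.uV + 2 * #st.uE := by
  have hXR : st.uV ⊆ R := h.uV_subset.trans h.verts_subset
  have hcount : ∑ u ∈ st.uV, #(st.nbrs u \ st.uV) =
      ∑ u ∈ st.verts \ st.uV, #(st.nbrs u ∩ st.uV) := by
    have := sum_card_bipartiteAbove_eq_sum_card_bipartiteBelow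
      (s := st.uV) (t := st.verts \ st.uV) (fun u v => v ∈ st.nbrs u)
    simp only [bipartiteAbove, bipartiteBelow] at this
    convert this using 1
    · refine sum_congr rfl fun u _ => congrArg card ?_
      ext v
      simp only [mem_sdiff, mem_filter]
      have : v ∈ st.nbrs u → v ∈ st.verts := fun hv => (mem_nbrs.1 hv).1
      tauto
    · refine sum_congr rfl fun v hv => congrArg card ?_
      ext u
      simp only [mem_inter, mem_filter, and_comm (a := u ∈ st.nbrs v)]
      refine and_congr_right fun hu => ?_
      exact mem_nbrs_comm (mem_sdiff.1 hv).1 (h.uV_subset hu)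
  have hle : ∑ u ∈ st.verts \ st.uV, #{v ∈ st.nbrs u | s(u, v) ∈ st.uE} ≤ 2 * #st.uE := by
    rw [← h.sum_card_incident]
    exact (sum_le_sum fun u _ => card_nbrs_filter_le u).trans
      (sum_le_sum_of_subset (sdiff_subset.trans h.verts_subset))
  rw [← sum_sdiff h.verts_subset, ← sum_sdiff h.uV_subset]
  have e1 : ∑ u ∈ R \ st.verts, (#(_root_.stepInf st u).uV : ℤ) = (#R - #st.verts) * #st.uV := by
    rw [sum_congr rfl fun u hu => by rw [card_uV_stepInf_of_notMem (mem_sdiff.1 hu).2],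
      sum_const, nsmul_eq_mul, cast_card_sdiff h.verts_subset]
  have e2 : ∑ u ∈ st.uV, (#(_root_.stepInf st u).uV : ℤ) =
      #st.uV * (#st.uV - 1) + ∑ u ∈ st.uV, (#(st.nbrs u \ st.uV) : ℤ) := by
    rw [sum_congr rfl fun u hu => card_uV_stepInf_of_mem_uV (h.uV_subset hu) hu,
      sum_add_distrib, sum_const, nsmul_eq_mul]
  have e3 : ∑ u ∈ st.verts \ st.uV, (#(_root_.stepInf st u).uV : ℤ) ≤
      (#st.verts - #st.uV) * #st.uV +
        ∑ u ∈ st.verts \ st.uV, (#{v ∈ st.nbrs u | s(u, v) ∈ st.uE} : ℤ) -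
        ∑ u ∈ st.verts \ st.uV, (#(st.nbrs u ∩ st.uV) : ℤ) := by
    refine (sum_le_sum fun u hu => card_uV_stepInf_le_of_notMem_uV (mem_sdiff.1 hu).1
      (mem_sdiff.1 hu).2).trans (le_of_eq ?_)
    rw [sum_sub_distrib, sum_add_distrib, sum_const, nsmul_eq_mul, cast_card_sdiff h.uV_subset]
  have hcount' : ∑ u ∈ st.uV, (#(st.nbrs u \ st.uV) : ℤ) =
      ∑ u ∈ st.verts \ st.uV, (#(st.nbrs u ∩ st.uV) : ℤ) := mod_cast hcount
  have hle' : ∑ u ∈ st.verts \ st.uV, (#{v ∈ st.nbrs u | s(u, v) ∈ st.uE} : ℤ) ≤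
      2 * #st.uE := mod_cast hle
  linarith

end MISState

section RandomPermutation

variable {n : ℕ}

lemma card_filter_le_val (j : ℕ) : #{k : Fin n | j ≤ (k : ℕ)} = n - j := by
  have h1 := card_filter_add_card_filter_not (s := (univ : Finset (Fin n))) (fun k => (k : ℕ) < j)
  simp only [Fin.card_filter_val_lt, not_lt, card_univ, Fintype.card_fin] at h1
  omega

/-- The vertices at positions `≥ j`. -/
def unprocessed (π : Equiv.Perm (Fin n)) (j : ℕ) : Finset (Fin n) :=
  {v | j ≤ (π.symm v : ℕ)}

lemma card_unprocessed (π : Equiv.Perm (Fin n)) (j : ℕ) : #(unprocessed π j) = n - j := by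
  have : unprocessed π j = ({k | j ≤ (k : ℕ)} : Finset (Fin n)).map π.toEmbedding := by
    ext v
    simp [unprocessed, mem_map_equiv]
  rw [this, card_map, card_filter_le_val]

lemma unprocessed_succ (π : Equiv.Perm (Fin n)) (j : Fin n) :
    unprocessed π (j + 1) = (unprocessed π j).erase (π j) := by
  ext v
  simp only [unprocessed, mem_filter, mem_univ, true_and, mem_erase, ne_eq,
    ← Equiv.symm_apply_eq, Fin.ext_iff]
  omega

lemma sum_unprocessed {M : Type*} [AddCommMonoid M] (π : Equiv.Perm (Fin n)) (j : ℕ)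
    (f : Fin n → M) :
    ∑ u ∈ unprocessed π j, f u = ∑ k ∈ ({k | j ≤ (k : ℕ)} : Finset (Fin n)), f (π k) := by
  symm
  refine sum_equiv π ?_ fun _ _ => rfl
  simp [unprocessed]

lemma stateAt_congr {π σ : Equiv.Perm (Fin n)} (st0 : MISState n) (j : ℕ)
    (h : ∀ i : Fin n, (i : ℕ) < j → π i = σ i) : stateAt π st0 j = stateAt σ st0 j := by
  induction j with
  | zero => rfl
  | succ j ih =>
    simp only [stateAt]
    rw [ih fun i hi => h i (by omega)]
    split_ifs with hj
    · rw [h ⟨j, hj⟩ (by simp)]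
    · rfl

lemma stateAt_succ (π : Equiv.Perm (Fin n)) (st0 : MISState n) (j : Fin n) :
    stateAt π st0 (j + 1) = stepInf (stateAt π st0 j) (π j) := by
  simp [stateAt]

lemma valid_stateAt {st0 : MISState n} (h0 : st0.Valid univ) (π : Equiv.Perm (Fin n)) {j : ℕ}
    (hj : j ≤ n) : (stateAt π st0 j).Valid (unprocessed π j) := by
  induction j with
  | zero => simpa [stateAt, unprocessed] using h0
  | succ j ih =>
    have := (ih (by omega)).stepInf (π ⟨j, hj⟩)
    rw [← unprocessed_succ π ⟨j, hj⟩] at this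
    rwa [stateAt_succ π st0 ⟨j, hj⟩]

/-- Given the first `j` positions, the vertex at position `j` is uniform among the others. -/
lemma sum_perm_stateAt (st0 : MISState n) (j : Fin n) (F : MISState n → Fin n → ℝ) :
    ((n : ℝ) - j) * ∑ π : Equiv.Perm (Fin n), F (stateAt π st0 j) (π j) =
      ∑ π : Equiv.Perm (Fin n), ∑ u ∈ unprocessed π j, F (stateAt π st0 j) u := by
  have hswap : ∀ k : Fin n, (j : ℕ) ≤ k →
      ∑ π : Equiv.Perm (Fin n), F (stateAt π st0 j) (π k) =
        ∑ π : Equiv.Perm (Fin n), F (stateAt π st0 j) (π j) := by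
    intro k hk
    refine Fintype.sum_equiv (Equiv.mulRight (Equiv.swap j k)) _ _ fun π => ?_
    have : stateAt (π * Equiv.swap j k) st0 j = stateAt π st0 j := by
      refine stateAt_congr st0 j fun i hi => ?_
      rw [Equiv.Perm.mul_apply, Equiv.swap_apply_of_ne_of_ne]
      · rintro rfl; omega
      · rintro rfl; omega
    simp [this]
  simp_rw [sum_unprocessed]
  rw [sum_comm, sum_congr rfl fun k hk => hswap k (mem_filter.1 hk).2, sum_const, nsmul_eq_mul,
    card_filter_le_val, Nat.cast_sub j.2.le]

lemma sum_card_uE_stateAt_le {st0 : MISState n} (h0 : st0.Valid univ) {j : ℕ} (hj : j ≤ n) :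
    (n : ℝ) * (n - 1) * ∑ π : Equiv.Perm (Fin n), (#(stateAt π st0 j).uE : ℝ) ≤
      (n - j) * (n - j - 1) * (Fintype.card (Equiv.Perm (Fin n)) * #st0.uE) := by
  induction j with
  | zero => simp [stateAt]
  | succ j ih =>
    specialize ih (by omega)
    have hm : (0 : ℝ) < n - j := by
      rw [sub_pos]; exact_mod_cast hj
    have hn : (0 : ℝ) ≤ n - 1 := by
      rw [sub_nonneg]; exact_mod_cast (by omega : 1 ≤ n)
    have hstep : ((n : ℝ) - j) * ∑ π : Equiv.Perm (Fin n), (#(stateAt π st0 (j + 1)).uE : ℝ) =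
        ∑ π : Equiv.Perm (Fin n), ∑ u ∈ unprocessed π j,
          (#(stepInf (stateAt π st0 j) u).uE : ℝ) := by
      simp_rw [fun π => stateAt_succ π st0 ⟨j, hj⟩]
      exact sum_perm_stateAt st0 ⟨j, hj⟩ fun st u => (#(stepInf st u).uE : ℝ)
    have hle : ∑ π : Equiv.Perm (Fin n), ∑ u ∈ unprocessed π j,
        (#(stepInf (stateAt π st0 j) u).uE : ℝ) ≤
        (n - j - 2) * ∑ π : Equiv.Perm (Fin n), (#(stateAt π st0 j).uE : ℝ) := by
      rw [mul_sum]
      refine sum_le_sum fun π _ => ?_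
      have := (valid_stateAt h0 π (j := j) (by omega)).sum_card_uE_stepInf_le
      rw [card_unprocessed, Nat.cast_sub (by omega)] at this
      exact_mod_cast this
    push_cast
    rw [← hstep] at hle
    set a := ∑ π : Equiv.Perm (Fin n), (#(stateAt π st0 j).uE : ℝ)
    set a' := ∑ π : Equiv.Perm (Fin n), (#(stateAt π st0 (j + 1)).uE : ℝ)
    set B := (Fintype.card (Equiv.Perm (Fin n)) * #st0.uE : ℝ)
    have ha' : 0 ≤ a' := sum_nonneg fun _ _ => by positivity
    have hB : 0 ≤ B := by positivity
    have hn0 : (0 : ℝ) ≤ n := by positivity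
    refine le_of_mul_le_mul_left ?_ hm
    rcases (by omega : n - j = 1 ∨ 2 ≤ n - j) with h1 | h2
    · have h1' : (n : ℝ) - j = 1 := by rw [← Nat.cast_sub (by omega), h1, Nat.cast_one]
      have ha : 0 ≤ a := sum_nonneg fun _ _ => by positivity
      rw [h1'] at hle
      have : a' = 0 := by linarith
      rw [this, show (n : ℝ) - (j + 1) = 0 by linarith]
      simp
    · have h2' : (0 : ℝ) ≤ n - j - 2 := by
        have : (2 : ℝ) ≤ ((n - j : ℕ) : ℝ) := mod_cast h2
        rw [Nat.cast_sub (by omega)] at this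
        linarith
      have k1 := mul_le_mul_of_nonneg_left hle (mul_nonneg hn0 hn)
      have k2 := mul_le_mul_of_nonneg_left ih h2'
      linarith

lemma sum_card_uV_stateAt_le {st0 : MISState n} (h0 : st0.Valid univ) (hV : st0.uV = ∅)
    {j : ℕ} (hj : j ≤ n) :
    (n : ℝ) * (n - 1) * ∑ π : Equiv.Perm (Fin n), (#(stateAt π st0 j).uV : ℝ) ≤
      2 * j * (n - j) * (Fintype.card (Equiv.Perm (Fin n)) * #st0.uE) := by
  induction j with
  | zero => simp [stateAt, hV]
  | succ j ih =>
    specialize ih (by omega)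
    have hm : (0 : ℝ) < n - j := by
      rw [sub_pos]; exact_mod_cast hj
    have hm1 : (0 : ℝ) ≤ n - j - 1 := by
      have : ((j + 1 : ℕ) : ℝ) ≤ n := mod_cast hj
      push_cast at this
      linarith
    have hn : (0 : ℝ) ≤ n - 1 := by
      rw [sub_nonneg]; exact_mod_cast (by omega : 1 ≤ n)
    have hE := sum_card_uE_stateAt_le h0 (j := j) (by omega)
    have hstep : ((n : ℝ) - j) * ∑ π : Equiv.Perm (Fin n), (#(stateAt π st0 (j + 1)).uV : ℝ) =
        ∑ π : Equiv.Perm (Fin n), ∑ u ∈ unprocessed π j,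
          (#(stepInf (stateAt π st0 j) u).uV : ℝ) := by
      simp_rw [fun π => stateAt_succ π st0 ⟨j, hj⟩]
      exact sum_perm_stateAt st0 ⟨j, hj⟩ fun st u => (#(stepInf st u).uV : ℝ)
    have hle : ∑ π : Equiv.Perm (Fin n), ∑ u ∈ unprocessed π j,
        (#(stepInf (stateAt π st0 j) u).uV : ℝ) ≤
        (n - j - 1) * ∑ π : Equiv.Perm (Fin n), (#(stateAt π st0 j).uV : ℝ) +
          2 * ∑ π : Equiv.Perm (Fin n), (#(stateAt π st0 j).uE : ℝ) := by
      rw [mul_sum, mul_sum, ← sum_add_distrib]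
      refine sum_le_sum fun π _ => ?_
      have := (valid_stateAt h0 π (j := j) (by omega)).sum_card_uV_stepInf_le
      rw [card_unprocessed, Nat.cast_sub (by omega)] at this
      exact_mod_cast this
    push_cast
    rw [← hstep] at hle
    have hn0 : (0 : ℝ) ≤ n := by positivity
    refine le_of_mul_le_mul_left ?_ hm
    have k1 := mul_le_mul_of_nonneg_left hle (mul_nonneg hn0 hn)
    have k2 := mul_le_mul_of_nonneg_left ih hm1
    linarith

/-- The number of permutations for which the vertex at position `j` joins the influence set. -/
lemma sum_perm_mem_uV_le (hn : 2 ≤ n) {st0 : MISState n} (h0 : st0.Valid univ)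
    (hV : st0.uV = ∅) (j : Fin n) :
    ∑ π : Equiv.Perm (Fin n), (if π j ∈ (stateAt π st0 j).uV then (1 : ℝ) else 0) ≤
      Fintype.card (Equiv.Perm (Fin n)) * (4 * #st0.uE * (j + 1) / (n : ℝ) ^ 2) := by
  have h := sum_perm_stateAt st0 j fun st u => if u ∈ st.uV then (1 : ℝ) else 0
  have h1 : ∀ π : Equiv.Perm (Fin n), ∑ u ∈ unprocessed π j,
      (if u ∈ (stateAt π st0 j).uV then (1 : ℝ) else 0) = #(stateAt π st0 j).uV := by
    intro π
    have hv := valid_stateAt h0 π j.2.le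
    rw [sum_boole, filter_mem_eq_inter, inter_eq_right.2 (hv.uV_subset.trans hv.verts_subset)]
  simp_rw [h1] at h
  have h2 := sum_card_uV_stateAt_le h0 hV j.2.le
  rw [← h] at h2
  set p := ∑ π : Equiv.Perm (Fin n), (if π j ∈ (stateAt π st0 j).uV then (1 : ℝ) else 0)
  set B := (Fintype.card (Equiv.Perm (Fin n)) * #st0.uE : ℝ) with hB
  have hp : 0 ≤ p := sum_nonneg fun _ _ => by positivity
  have hB0 : 0 ≤ B := by positivity
  have hm : (0 : ℝ) < n - j := by
    rw [sub_pos]; exact_mod_cast j.2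
  have hn' : (2 : ℝ) ≤ n := mod_cast hn
  have h3 : (n : ℝ) * (n - 1) * p ≤ 2 * j * B := by
    refine le_of_mul_le_mul_left ?_ hm
    linarith
  have h4 : (n : ℝ) ^ 2 ≤ 2 * (n * (n - 1)) := by nlinarith
  have h5 : (n : ℝ) ^ 2 * p ≤ 4 * B * (j + 1) := by
    have := mul_le_mul_of_nonneg_right h4 hp
    linarith
  rw [show (Fintype.card (Equiv.Perm (Fin n)) : ℝ) * (4 * #st0.uE * (j + 1) / (n : ℝ) ^ 2) =
    4 * B * (j + 1) / (n : ℝ) ^ 2 by rw [hB]; ring, le_div_iff₀ (by positivity)]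
  linarith

end RandomPermutation

lemma sum_Ico_inv_le {t n : ℕ} (ht : t ≤ n) :
    ∑ i ∈ Ico t n, ((i : ℝ) + 1)⁻¹ ≤ 1 + Real.log n - Real.log (t + 1) := by
  have key : ∀ m : ℕ, ((harmonic m : ℚ) : ℝ) = ∑ i ∈ range m, ((i : ℝ) + 1)⁻¹ := by
    intro m
    simp [harmonic]
  have h1 := harmonic_le_one_add_log n
  have h2 := log_add_one_le_harmonic t
  rw [key] at h1 h2
  rw [sum_Ico_eq_sub _ ht]
  push_cast at h2
  linarith

lemma sum_mul_min_sq_le {n Δ : ℕ} (hn : 2 ≤ n) (hΔ : 2 ≤ Δ) :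
    ∑ j : Fin n, ((j : ℕ) + 1 : ℝ) *
        min ((Δ : ℝ) ^ 2) (((n : ℝ) * Real.logb 2 n / ((j : ℕ) + 1 : ℝ)) ^ 2) ≤
      3 * (n : ℝ) ^ 2 * Real.logb 2 n ^ 2 * Real.logb 2 Δ := by
  rw [Fin.sum_univ_eq_sum_range fun i : ℕ => ((i : ℝ) + 1) *
    min ((Δ : ℝ) ^ 2) (((n : ℝ) * Real.logb 2 n / ((i : ℝ) + 1)) ^ 2)]
  have hn' : (2 : ℝ) ≤ n := mod_cast hn
  have hΔ' : (2 : ℝ) ≤ Δ := mod_cast hΔ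
  have one_le_logb : ∀ x : ℝ, 2 ≤ x → 1 ≤ Real.logb 2 x := fun x hx => by
    rwa [Real.le_logb_iff_rpow_le (by norm_num) (by linarith), Real.rpow_one]
  have hL := one_le_logb n hn'
  have hD := one_le_logb Δ hΔ'
  have hlog : Real.log Δ ≤ Real.logb 2 Δ := by
    rw [Real.logb, le_div_iff₀ (Real.log_pos (by norm_num))]
    have : 0 ≤ Real.log Δ := Real.log_nonneg (by linarith)
    nlinarith [Real.log_two_lt_d9]
  set L := Real.logb 2 n
  have hL2 : 1 ≤ L ^ 2 := one_le_pow₀ hL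
  set t := n / Δ
  have htn : t ≤ n := Nat.div_le_self _ _
  have ht1 : (t : ℝ) * Δ ≤ n := mod_cast Nat.div_mul_le_self n Δ
  have ht2 : (n : ℝ) ≤ (t + 1) * Δ := by
    have := Nat.lt_div_mul_add (a := n) (b := Δ) (by omega)
    have : n ≤ (t + 1) * Δ := by rw [add_mul, one_mul]; exact this.le
    exact_mod_cast this
  rw [← sum_range_add_sum_Ico _ htn]
  have hlow : ∑ i ∈ range t, ((i : ℝ) + 1) *
      min ((Δ : ℝ) ^ 2) (((n : ℝ) * L / ((i : ℝ) + 1)) ^ 2) ≤ (n : ℝ) ^ 2 := by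
    have : ∀ i ∈ range t, ((i : ℝ) + 1) *
        min ((Δ : ℝ) ^ 2) (((n : ℝ) * L / ((i : ℝ) + 1)) ^ 2) ≤ t * (Δ : ℝ) ^ 2 := by
      intro i hi
      have : (i : ℝ) + 1 ≤ t := mod_cast mem_range.1 hi
      exact mul_le_mul this (min_le_left _ _) (by positivity) (by positivity)
    refine (sum_le_sum this).trans ?_
    rw [sum_const, card_range, nsmul_eq_mul]
    nlinarith [pow_le_pow_left₀ (by positivity) ht1 2]
  have hhigh : ∑ i ∈ Ico t n, ((i : ℝ) + 1) *
      min ((Δ : ℝ) ^ 2) (((n : ℝ) * L / ((i : ℝ) + 1)) ^ 2) ≤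
      (n : ℝ) ^ 2 * L ^ 2 * (1 + Real.log Δ) := by
    have : ∀ i ∈ Ico t n, ((i : ℝ) + 1) *
        min ((Δ : ℝ) ^ 2) (((n : ℝ) * L / ((i : ℝ) + 1)) ^ 2) ≤
        (n : ℝ) ^ 2 * L ^ 2 * ((i : ℝ) + 1)⁻¹ := by
      intro i _
      refine (mul_le_mul_of_nonneg_left (min_le_right _ _) (by positivity)).trans (le_of_eq ?_)
      field_simp
    refine (sum_le_sum this).trans ?_
    rw [← mul_sum]
    refine mul_le_mul_of_nonneg_left ((sum_Ico_inv_le htn).trans ?_) (by positivity)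
    have := Real.log_le_log (by positivity) ht2
    rw [Real.log_mul (by positivity) (by positivity)] at this
    linarith
  have hmain : (n : ℝ) ^ 2 * 1 + (n : ℝ) ^ 2 * L ^ 2 * (1 + Real.log Δ) ≤
      (n : ℝ) ^ 2 * (L ^ 2 * Real.logb 2 Δ) +
        (n : ℝ) ^ 2 * L ^ 2 * (Real.logb 2 Δ + Real.logb 2 Δ) := by
    gcongr
    exact one_le_mul_of_one_le_of_one_le hL2 hD
  linarith

/-- There is an absolute constant `C` such that: for any graph `G = (V,E)` on
`n ≥ 2` vertices, non-edges `E₊`, deleted edges `E₋ ⊆ E`, `b = |E₊| + |E₋|`, and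
`Δ ≥ 2` the maximum degree of `(V, E ∪ E₊)`, running `InfluenceMIS` on
`(V, E ∪ E₊)` with `V₁? = ∅`, `E₁? = E₊ ∪ E₋` and a uniformly random permutation,
the expectation of `Σ_j Z_j · 1[π(j) is added to the influence set at iteration j]`,
with `Z_j = min(Δ², ((n log n)/j)²)`, is at most `C · b · log² n · log Δ`
(stated as: the sum over all permutations is at most `n!` times that bound). -/
theorem expected_two_hop_cost :
    ∃ C : ℝ, 0 < C ∧
      ∀ n : ℕ, 2 ≤ n → ∀ (G : SimpleGraph (Fin n)) [DecidableRel G.Adj],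
        ∀ Eplus Eminus : Finset (Sym2 (Fin n)),
          (∀ e ∈ Eplus, ¬ e.IsDiag ∧ e ∉ G.edgeFinset) → Eminus ⊆ G.edgeFinset →
          ∀ Δ : ℕ, 2 ≤ Δ →
            Δ = Finset.univ.sup
              (fun v : Fin n => ((G.edgeFinset ∪ Eplus).filter fun e => v ∈ e).card) →
            (∑ π : Equiv.Perm (Fin n), ∑ j : Fin n,
                if π j ∈ (stateAt π ⟨Finset.univ, G.edgeFinset ∪ Eplus, ∅,
                      Eplus ∪ Eminus⟩ (j : ℕ)).verts ∧
                    π j ∈ (stateAt π ⟨Finset.univ, G.edgeFinset ∪ Eplus, ∅,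
                      Eplus ∪ Eminus⟩ (j : ℕ)).uV
                then min ((Δ : ℝ) ^ 2)
                  (((n : ℝ) * Real.logb 2 n / ((j : ℕ) + 1 : ℝ)) ^ 2)
                else 0)
              ≤ (Fintype.card (Equiv.Perm (Fin n)) : ℝ) *
                  (C * ((Eplus.card + Eminus.card : ℕ) : ℝ) *
                    (Real.logb 2 n) ^ 2 * Real.logb 2 Δ) := by
  refine ⟨12, by norm_num, ?_⟩
  intro n hn G _ Eplus Eminus hplus hminus Δ hΔ _
  set st0 : MISState n := ⟨univ, G.edgeFinset ∪ Eplus, ∅, Eplus ∪ Eminus⟩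
  have h0 : st0.Valid univ := by
    refine ⟨empty_subset _, subset_rfl, fun e _ v _ => mem_univ v, fun e he => ?_⟩
    rcases mem_union.1 he with he | he
    · exact (hplus e he).1
    · exact G.not_isDiag_of_mem_edgeFinset (hminus he)
  have hb : (#st0.uE : ℝ) ≤ ((Eplus.card + Eminus.card : ℕ) : ℝ) :=
    mod_cast card_union_le _ _
  set b : ℝ := ((Eplus.card + Eminus.card : ℕ) : ℝ)
  set N : ℝ := (Fintype.card (Equiv.Perm (Fin n)) : ℝ)
  set Z : Fin n → ℝ := fun j =>
    min ((Δ : ℝ) ^ 2) (((n : ℝ) * Real.logb 2 n / ((j : ℕ) + 1 : ℝ)) ^ 2)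
  have hZ : ∀ j, 0 ≤ Z j := fun j => le_min (by positivity) (by positivity)
  have hn' : (0 : ℝ) < n := by positivity
  calc _ ≤ ∑ π : Equiv.Perm (Fin n), ∑ j : Fin n,
        Z j * (if π j ∈ (stateAt π st0 j).uV then (1 : ℝ) else 0) := by
        refine sum_le_sum fun π _ => sum_le_sum fun j _ => ?_
        rw [mul_ite, mul_one, mul_zero]
        split_ifs with h1 h2 h2
        · exact le_rfl
        · exact absurd h1.2 h2
        · exact hZ j
        · exact le_rfl
    _ = ∑ j : Fin n, Z j *
        ∑ π : Equiv.Perm (Fin n), (if π j ∈ (stateAt π st0 j).uV then (1 : ℝ) else 0) := by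
        rw [sum_comm]
        simp_rw [mul_sum]
    _ ≤ ∑ j : Fin n, Z j * (N * (4 * b * (j + 1) / (n : ℝ) ^ 2)) := by
        refine sum_le_sum fun j _ => mul_le_mul_of_nonneg_left ?_ (hZ j)
        refine (sum_perm_mem_uV_le hn h0 rfl j).trans ?_
        gcongr
    _ = N * (4 * b / (n : ℝ) ^ 2) * ∑ j : Fin n, ((j : ℕ) + 1 : ℝ) * Z j := by
        rw [mul_sum]
        exact sum_congr rfl fun j _ => by ring
    _ ≤ N * (4 * b / (n : ℝ) ^ 2) *
        (3 * (n : ℝ) ^ 2 * Real.logb 2 n ^ 2 * Real.logb 2 Δ) :=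
        mul_le_mul_of_nonneg_left (sum_mul_min_sq_le hn hΔ) (by positivity)
    _ = _ := by
        field_simp
        ring
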